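/- arXiv:2511.11897 — 8 statements merged into one kernel-verified Lean document; each statement's English description precedes it below -/
import Mathlib

section
/- Let λ > 0 and η ∈ (0, 1), let t₀ ≤ T be real numbers, and let ψ : ℝ → ℝ be differentiable on [t₀, T] with ψ(t) ≥ 0 for all t ∈ [t₀, T] and ψ'(t) ≥ -λ·ψ(t)^η for all t ∈ [t₀, T]. Then for all t ∈ [t₀, T], ψ(t) ≥ (max(ψ(t₀)^{1-η} - λ·(1-η)·(t - t₀), 0))^{1/(1-η)}. -/
/-- Comparison-lemma bound (Eq. (11), case 0 < η < 1): a nonnegative scalar function whose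
derivative satisfies a sublinear power damping differential inequality is bounded below by
the truncated power solution. -/
theorem stmt_1 (lam η t₀ T : ℝ) (hlam : 0 < lam) (hη : η ∈ Set.Ioo (0:ℝ) 1) (htT : t₀ ≤ T)
    (ψ ψ' : ℝ → ℝ)
    (hderiv : ∀ t ∈ Set.Icc t₀ T, HasDerivWithinAt ψ (ψ' t) (Set.Icc t₀ T) t)
    (hnonneg : ∀ t ∈ Set.Icc t₀ T, 0 ≤ ψ t)
    (hineq : ∀ t ∈ Set.Icc t₀ T, ψ' t ≥ -lam * ψ t ^ η) :
    ∀ t ∈ Set.Icc t₀ T,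
      ψ t ≥ (max (ψ t₀ ^ (1 - η) - lam * (1 - η) * (t - t₀)) 0) ^ (1 / (1 - η)) := by
  have h1 : 0 < 1 - η := sub_pos.2 hη.2
  have hc : 0 < lam * (1 - η) := mul_pos hlam h1
  have key : ∀ ⦃t⦄, t ∈ Set.Icc t₀ T →
      -(ψ t ^ (1 - η)) ≤ -(ψ t₀ ^ (1 - η)) + lam * (1 - η) * (t - t₀) := by
    refine image_le_of_liminf_slope_right_le_deriv_boundary (B' := fun _ ↦ lam * (1 - η))
      ?_ (by simp) (by fun_prop) ?_ ?_
    · exact (ContinuousOn.rpow_const (fun t ht ↦ (hderiv t ht).continuousWithinAt)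
        fun _ _ ↦ Or.inr h1.le).neg
    · intro x _
      simpa using ((((hasDerivAt_id x).sub_const t₀).const_mul (lam * (1 - η))).const_add
        (-(ψ t₀ ^ (1 - η)))).hasDerivWithinAt (s := Set.Ici x)
    · intro x hx r hr
      have hx' := Set.Ico_subset_Icc_self hx
      rcases (hnonneg x hx').eq_or_lt with h0 | hpos
      · refine Filter.Eventually.frequently ?_
        filter_upwards [Ioo_mem_nhdsGT hx.2] with z hz
        have hz0 := Real.rpow_nonneg (hnonneg z ⟨hx.1.trans hz.1.le, hz.2.le⟩) (1 - η)
        refine lt_of_le_of_lt ?_ (hc.trans hr)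
        rw [slope_def_field, ← h0, Real.zero_rpow h1.ne']
        exact div_nonpos_of_nonpos_of_nonneg (by linarith) (sub_nonneg.2 hz.1.le)
      · have hd := ((hderiv x hx').rpow_const (p := 1 - η)
          (Or.inl hpos.ne')).neg.mono_of_mem_nhdsWithin (Icc_mem_nhdsGE_of_mem hx)
        refine hd.liminf_right_slope_le (lt_of_le_of_lt ?_ hr)
        have hp : ψ x ^ η * ψ x ^ (1 - η - 1) = 1 := by
          rw [← Real.rpow_add hpos]; simp
        have hm := mul_le_mul_of_nonneg_right (hineq x hx')
          (mul_nonneg h1.le (Real.rpow_nonneg hpos.le (1 - η - 1)))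
        linear_combination hm + lam * (1 - η) * hp
  intro t ht
  have hψ := hnonneg t ht
  calc _ ≤ (ψ t ^ (1 - η)) ^ (1 / (1 - η)) := by
        refine Real.rpow_le_rpow (le_max_right _ _) (max_le ?_ (Real.rpow_nonneg hψ _))
          (one_div_pos.2 h1).le
        linarith [key ht]
    _ = ψ t := by rw [one_div, Real.rpow_rpow_inv hψ h1.ne']
end

section
/- Let α : ℝ → ℝ be locally Lipschitz with α(0) = 0 and strictly increasing, and let ψ : ℝ → ℝ be differentiable on [0, ∞) with ψ(0) ≥ 0 and ψ'(t) ≥ -α(ψ(t)) for all t ≥ 0. Then ψ(t) ≥ 0 for all t ≥ 0. -/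
/-- Trajectory form of the basic CBF positivity guarantee: for a locally Lipschitz class-κ
function α, the damping differential inequality ψ' ≥ -α(ψ) together with ψ(0) ≥ 0 renders
{ψ ≥ 0} forward invariant. -/
theorem stmt_3 (α : ℝ → ℝ) (hlip : LocallyLipschitz α) (hα0 : α 0 = 0)
    (hmono : StrictMono α)
    (ψ ψ' : ℝ → ℝ)
    (hderiv : ∀ t ∈ Set.Ici (0:ℝ), HasDerivWithinAt ψ (ψ' t) (Set.Ici 0) t)
    (h0 : 0 ≤ ψ 0)
    (hineq : ∀ t ≥ (0:ℝ), ψ' t ≥ -α (ψ t)) :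
    ∀ t ≥ (0:ℝ), 0 ≤ ψ t := by
  intro t ht
  refine le_of_forall_pos_sub_le fun ε hε => ?_
  have hneg : α (-ε) < 0 := hα0 ▸ hmono (neg_lt_zero.mpr hε)
  have key : -ψ t ≤ ε := by
    refine image_le_of_deriv_right_lt_deriv_boundary' (f := fun s => -ψ s) (f' := fun s => -ψ' s)
      (a := 0) (b := t) (B := fun _ => ε) (B' := fun _ => 0) ?_ ?_ (by linarith)
      continuousOn_const (fun x _ => hasDerivWithinAt_const x _ ε) ?_ ⟨ht, le_rfl⟩
    · exact fun x hx => ((hderiv x hx.1).continuousWithinAt.mono Set.Icc_subset_Ici_self).neg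
    · exact fun x hx => ((hderiv x hx.1).mono (Set.Ici_subset_Ici.mpr hx.1)).fun_neg
    · intro x hx hxε
      have hψ : ψ x = -ε := by linarith
      have hx' := hineq x hx.1
      rw [hψ] at hx'
      linarith
  linarith
end

section
/- Let m ≥ 1 and let α₁, …, α_m : ℝ → ℝ each be locally Lipschitz with α_i(0) = 0 and strictly increasing. Let ψ₀, …, ψ_m : [0, ∞) → ℝ be such that ψ₀, …, ψ_{m-1} are differentiable and ψ_i(t) = ψ_{i-1}'(t) + α_i(ψ_{i-1}(t)) for all t ≥ 0 and i ∈ {1, …, m}. If ψ_i(0) ≥ 0 for every i ∈ {0, …, m-1} and ψ_m(t) ≥ 0 for all t ≥ 0, then ψ_i(t) ≥ 0 for every i ∈ {0, …, m-1} and all t ≥ 0; in particular ψ₀(t) ≥ 0 for all t ≥ 0. -/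
/-- A function on `[0, ∞)` that starts nonnegative and satisfies `f' + a ∘ f ≥ 0`, where `a` is
negative on the negative reals, stays nonnegative. -/
theorem nonneg_of_deriv_add_comp_nonneg {a f f' : ℝ → ℝ} (ha : ∀ x < 0, a x < 0)
    (hf : ∀ t ∈ Set.Ici (0 : ℝ), HasDerivWithinAt f (f' t) (Set.Ici 0) t)
    (hf' : ∀ t ≥ (0 : ℝ), 0 ≤ f' t + a (f t)) (h0 : 0 ≤ f 0) :
    ∀ t ≥ (0 : ℝ), 0 ≤ f t := by
  intro t ht
  refine le_of_forall_pos_le_add fun ε hε => ?_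
  have key : -f t ≤ ε := by
    refine image_le_of_deriv_right_lt_deriv_boundary (f := fun x => -f x) (f' := fun x => -f' x)
      (B := fun _ => ε) (B' := fun _ => 0) (a := 0) (b := t) ?_ ?_ ?_
      (fun x => hasDerivAt_const x ε) ?_ ⟨ht, le_rfl⟩
    · exact fun x hx => ((hf x hx.1).neg.continuousWithinAt).mono Set.Icc_subset_Ici_self
    · exact fun x hx => (hf x hx.1).neg.mono (Set.Ici_subset_Ici.2 hx.1)
    · linarith
    · intro x hx hfx
      have h1 := hf' x hx.1
      have h2 := ha (f x) (by linarith)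
      linarith
  linarith


/-- Trajectory form of the HOCBF safety guarantee (Theorem 1): nonnegativity of the
highest-order function ψ_m along the trajectory, together with initial membership in all
sets C_i = {ψ_{i-1} ≥ 0}, renders their intersection forward invariant. -/
theorem stmt_4 (m : ℕ) (hm : 1 ≤ m) (α : ℕ → ℝ → ℝ)
    (hlip : ∀ i, 1 ≤ i → i ≤ m → LocallyLipschitz (α i))
    (hα0 : ∀ i, 1 ≤ i → i ≤ m → α i 0 = 0)
    (hmono : ∀ i, 1 ≤ i → i ≤ m → StrictMono (α i))
    (ψ ψ' : ℕ → ℝ → ℝ)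
    (hderiv : ∀ i < m, ∀ t ∈ Set.Ici (0:ℝ), HasDerivWithinAt (ψ i) (ψ' i t) (Set.Ici 0) t)
    (hcascade : ∀ i, 1 ≤ i → i ≤ m → ∀ t ≥ (0:ℝ), ψ i t = ψ' (i - 1) t + α i (ψ (i - 1) t))
    (hinit : ∀ i < m, 0 ≤ ψ i 0)
    (htop : ∀ t ≥ (0:ℝ), 0 ≤ ψ m t) :
    ∀ i < m, ∀ t ≥ (0:ℝ), 0 ≤ ψ i t := by
  have step : ∀ i < m, (∀ t ≥ (0 : ℝ), 0 ≤ ψ (i + 1) t) → ∀ t ≥ (0 : ℝ), 0 ≤ ψ i t := by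
    intro i hi hnext
    have hneg : ∀ x < 0, α (i + 1) x < 0 := fun x hx =>
      (hmono (i + 1) (by omega) hi hx).trans_eq (hα0 (i + 1) (by omega) hi)
    refine nonneg_of_deriv_add_comp_nonneg hneg (hderiv i hi) (fun t ht => ?_) (hinit i hi)
    have h := hcascade (i + 1) (by omega) hi t ht
    rw [Nat.add_sub_cancel] at h
    exact h ▸ hnext t ht
  intro i hi
  exact Nat.decreasingInduction (motive := fun k _ => ∀ t ≥ (0 : ℝ), 0 ≤ ψ k t)
    step htop hi.le
end

section
/- Let ψ₀ ≥ 0, L ≥ 0, M ≥ 0 and Δt > 0, and define l : ℝ → ℝ by l(τ) = ψ₀ + τ·((L - ψ₀)/Δt + M·Δt/2) - (M·τ²)/2. Then l(τ) ≥ 0 for all τ ∈ [0, Δt], and l(Δt) = L. -/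
/-- The quadratic lower minorant l(τ) from the SACBF safety-guarantee proof (Eq. (20)) is
nonnegative on [0, Δt] and equals L at τ = Δt. -/
theorem stmt_6 (ψ₀ L M Δt : ℝ) (hψ₀ : 0 ≤ ψ₀) (hL : 0 ≤ L) (hM : 0 ≤ M) (hΔ : 0 < Δt)
    (l : ℝ → ℝ)
    (hl : ∀ τ : ℝ, l τ = ψ₀ + τ * ((L - ψ₀) / Δt + M * Δt / 2) - M * τ ^ 2 / 2) :
    (∀ τ ∈ Set.Icc (0:ℝ) Δt, 0 ≤ l τ) ∧ l Δt = L := by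
  have chord : ∀ τ, l τ = ψ₀ * (Δt - τ) / Δt + L * τ / Δt + M * τ * (Δt - τ) / 2 := by
    intro τ
    rw [hl]
    field_simp
    ring
  refine ⟨?_, ?_⟩
  · rintro τ ⟨hτ, hτΔ⟩
    have hsub : 0 ≤ Δt - τ := sub_nonneg.mpr hτΔ
    rw [chord]
    positivity
  · rw [chord, sub_self]
    field_simp
    ring
end

section
/- Let t_k be a real number, Δt > 0, M ≥ 0 and L ≥ 0, and let ψ : ℝ → ℝ be twice differentiable on [t_k, t_k + Δt] with ψ''(t) ≥ -M for all t ∈ [t_k, t_k + Δt]. If ψ(t_k) ≥ 0 and ψ'(t_k) ≥ (L - ψ(t_k))/Δt + M·Δt/2, then ψ(t) ≥ 0 for all t ∈ [t_k, t_k + Δt], and moreover ψ(t_k + Δt) ≥ L. -/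
open Set in
/-- Second-order Taylor lower bound from a lower bound on the second derivative. -/
theorem taylor_lower_bound_of_neg_le_second_deriv {a b M : ℝ} {f f' f'' : ℝ → ℝ}
    (hf : ∀ t ∈ Icc a b, HasDerivWithinAt f (f' t) (Icc a b) t)
    (hf' : ∀ t ∈ Icc a b, HasDerivWithinAt f' (f'' t) (Icc a b) t)
    (hf'' : ∀ t ∈ Icc a b, -M ≤ f'' t) {t : ℝ} (ht : t ∈ Icc a b) :
    f a + f' a * (t - a) - M * (t - a) ^ 2 / 2 ≤ f t := by
  have ha : a ∈ Icc a b := left_mem_Icc.2 (ht.1.trans ht.2)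
  have mono {g g' : ℝ → ℝ} (hg : ∀ t ∈ Icc a b, HasDerivWithinAt g (g' t) (Icc a b) t)
      (hg' : ∀ t ∈ Icc a b, 0 ≤ g' t) {t : ℝ} (ht : t ∈ Icc a b) : g a ≤ g t :=
    monotoneOn_of_hasDerivWithinAt_nonneg (convex_Icc a b)
      (fun x hx ↦ (hg x hx).continuousWithinAt)
      (fun x hx ↦ (hg x (interior_subset hx)).mono interior_subset)
      (fun x hx ↦ hg' x (interior_subset hx)) ha ht ht.1
  have first : ∀ x ∈ Icc a b, 0 ≤ f' x - f' a + M * (x - a) := by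
    intro x hx
    have h := mono (g := fun x ↦ f' x + M * (x - a)) (g' := fun x ↦ f'' x + M * 1)
      (fun x hx ↦ (hf' x hx).add (((hasDerivWithinAt_id x _).sub_const a).const_mul M))
      (fun x hx ↦ by linarith [hf'' x hx]) hx
    simp only [sub_self, mul_zero] at h
    linarith
  have h := mono (g := fun x ↦ f x - f' a * (x - a) + M / 2 * (x - a) ^ 2)
    (g' := fun x ↦ f' x - f' a + M * (x - a))
    (fun x hx ↦ by
      have hid := (hasDerivWithinAt_id x (Icc a b)).sub_const a
      refine (((hf x hx).sub (hid.const_mul (f' a))).add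
        ((hid.pow 2).const_mul (M / 2))).congr_deriv ?_
      norm_num
      ring)
    first ht
  simp only [sub_self] at h
  linarith

/-- Single-sampling-interval core of the SACBF safety guarantee (Theorem 2): the SACBF
condition imposed only at the sampling instant guarantees nonnegativity of the barrier
throughout the sampling interval and the end-point bound ψ(t_k + Δt) ≥ L. -/
theorem stmt_7 (tk Δt M L : ℝ) (hΔ : 0 < Δt) (hM : 0 ≤ M) (hL : 0 ≤ L)
    (ψ ψ' ψ'' : ℝ → ℝ)
    (hd1 : ∀ t ∈ Set.Icc tk (tk + Δt), HasDerivWithinAt ψ (ψ' t) (Set.Icc tk (tk + Δt)) t)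
    (hd2 : ∀ t ∈ Set.Icc tk (tk + Δt), HasDerivWithinAt ψ' (ψ'' t) (Set.Icc tk (tk + Δt)) t)
    (hbound : ∀ t ∈ Set.Icc tk (tk + Δt), ψ'' t ≥ -M)
    (h0 : 0 ≤ ψ tk)
    (hSACBF : ψ' tk ≥ (L - ψ tk) / Δt + M * Δt / 2) :
    (∀ t ∈ Set.Icc tk (tk + Δt), 0 ≤ ψ t) ∧ ψ (tk + Δt) ≥ L := by
  have taylor := fun t (ht : t ∈ Set.Icc tk (tk + Δt)) ↦
    taylor_lower_bound_of_neg_le_second_deriv hd1 hd2 hbound ht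
  have slope : L - ψ tk + M * Δt ^ 2 / 2 ≤ ψ' tk * Δt := by
    have h := mul_le_mul_of_nonneg_right hSACBF hΔ.le
    rw [add_mul, div_mul_cancel₀ _ hΔ.ne'] at h
    linarith
  constructor
  · intro t ht
    have hs : 0 ≤ t - tk := sub_nonneg.2 ht.1
    have hr : 0 ≤ Δt - (t - tk) := by linarith [ht.2]
    refine nonneg_of_mul_nonneg_right ?_ hΔ
    have hT := mul_le_mul_of_nonneg_left (taylor t ht) hΔ.le
    have hS := mul_le_mul_of_nonneg_left slope hs
    have h1 := mul_nonneg h0 hr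
    have h2 := mul_nonneg hL hs
    have h3 := mul_nonneg (mul_nonneg (mul_nonneg hM hs) hr) hΔ.le
    linarith
  · have h := taylor (tk + Δt) (Set.right_mem_Icc.2 (by linarith))
    rw [add_sub_cancel_left] at h
    linarith
end

section
/- Let Δt > 0 and let ψ : ℝ → ℝ be twice differentiable on [0, ∞) with ψ(0) ≥ 0. Suppose that for every k ∈ ℕ there exist L_k ≥ 0 and M_k ≥ 0 such that ψ''(t) ≥ -M_k for all t ∈ [k·Δt, (k+1)·Δt] and ψ'(k·Δt) ≥ (L_k - ψ(k·Δt))/Δt + M_k·Δt/2. Then ψ(t) ≥ 0 for all t ≥ 0. -/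
/-- Second-order Taylor lower bound on an interval where the second derivative is at least `c`. -/
theorem taylor_lower_bound_of_le_second_deriv {f f' f'' : ℝ → ℝ} {a b c : ℝ}
    (hf : ∀ t ∈ Set.Icc a b, HasDerivWithinAt f (f' t) (Set.Icc a b) t)
    (hf' : ∀ t ∈ Set.Icc a b, HasDerivWithinAt f' (f'' t) (Set.Icc a b) t)
    (hc : ∀ t ∈ Set.Icc a b, c ≤ f'' t) {t : ℝ} (ht : t ∈ Set.Icc a b) :
    f a + f' a * (t - a) + c / 2 * (t - a) ^ 2 ≤ f t := by
  have ha : a ∈ Set.Icc a b := ⟨le_rfl, ht.1.trans ht.2⟩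
  have hslope : ∀ u ∈ Set.Icc a b, f' a + c * (u - a) ≤ f' u := by
    have hd : ∀ u ∈ Set.Icc a b,
        HasDerivWithinAt (fun u => f' u - c * (u - a)) (f'' u - c * 1) (Set.Icc a b) u :=
      fun u hu => (hf' u hu).sub (((hasDerivWithinAt_id u _).sub_const a).const_mul c)
    have hm := monotoneOn_of_hasDerivWithinAt_nonneg (convex_Icc a b)
      (fun u hu => (hd u hu).continuousWithinAt)
      (fun u hu => (hd u (interior_subset hu)).mono interior_subset)
      (fun u hu => by linarith [hc u (interior_subset hu)])
    intro u hu
    have := hm ha hu hu.1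
    simp only [sub_self, mul_zero] at this
    linarith
  have hd : ∀ u ∈ Set.Icc a b,
      HasDerivWithinAt (fun u => f u - f' a * (u - a) - c / 2 * (u - a) ^ 2)
        (f' u - f' a - c * (u - a)) (Set.Icc a b) u := by
    intro u hu
    have hid := (hasDerivWithinAt_id u (Set.Icc a b)).sub_const a
    refine (((hf u hu).sub (hid.const_mul (f' a))).sub
      ((hid.pow 2).const_mul (c / 2))).congr_deriv ?_
    simp only [id]
    ring
  have hm := monotoneOn_of_hasDerivWithinAt_nonneg (convex_Icc a b)
    (fun u hu => (hd u hu).continuousWithinAt)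
    (fun u hu => (hd u (interior_subset hu)).mono interior_subset)
    (fun u hu => by linarith [hslope u (interior_subset hu)])
  have := hm ha ht ht.1
  simp only [sub_self, mul_zero, ne_eq, OfNat.ofNat_ne_zero, not_false_eq_true, zero_pow] at this
  linarith

/-- Iterated (all sampling intervals) scalar form of the SACBF safety guarantee (Theorem 2):
enforcing the SACBF condition at every sampling instant t_k = k·Δt guarantees continuous-time
nonnegativity of the barrier function for all time. -/
theorem stmt_8 (Δt : ℝ) (hΔ : 0 < Δt)
    (ψ ψ' ψ'' : ℝ → ℝ)
    (hd1 : ∀ t ∈ Set.Ici (0:ℝ), HasDerivWithinAt ψ (ψ' t) (Set.Ici 0) t)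
    (hd2 : ∀ t ∈ Set.Ici (0:ℝ), HasDerivWithinAt ψ' (ψ'' t) (Set.Ici 0) t)
    (h0 : 0 ≤ ψ 0)
    (hk : ∀ k : ℕ, ∃ L M : ℝ, 0 ≤ L ∧ 0 ≤ M ∧
      (∀ t ∈ Set.Icc ((k : ℝ) * Δt) (((k : ℝ) + 1) * Δt), ψ'' t ≥ -M) ∧
      ψ' ((k : ℝ) * Δt) ≥ (L - ψ ((k : ℝ) * Δt)) / Δt + M * Δt / 2) :
    ∀ t ≥ (0:ℝ), 0 ≤ ψ t := by
  have hstep : ∀ k : ℕ, 0 ≤ ψ (k * Δt) →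
      ∀ t ∈ Set.Icc ((k : ℝ) * Δt) (((k : ℝ) + 1) * Δt), 0 ≤ ψ t := by
    intro k hψ t ht
    obtain ⟨L, M, hL, hM, hcurv, hslope⟩ := hk k
    have hsub : Set.Icc ((k : ℝ) * Δt) (((k : ℝ) + 1) * Δt) ⊆ Set.Ici 0 :=
      fun u hu => le_trans (by positivity) hu.1
    have htaylor := taylor_lower_bound_of_le_second_deriv
      (fun u hu => (hd1 u (hsub hu)).mono hsub) (fun u hu => (hd2 u (hsub hu)).mono hsub) hcurv ht
    have hs : 0 ≤ t - k * Δt := by linarith [ht.1]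
    have hs' : 0 ≤ Δt - (t - k * Δt) := by linarith [ht.2]
    refine le_trans ?_ htaylor
    generalize t - k * Δt = s at hs hs' ⊢
    generalize ψ (k * Δt) = p at hψ hslope ⊢
    calc 0 ≤ p * (Δt - s) / Δt + L * s / Δt + M / 2 * (s * (Δt - s)) := by positivity
      _ = p + ((L - p) / Δt + M * Δt / 2) * s + -M / 2 * s ^ 2 := by field_simp; ring
      _ ≤ _ := by gcongr
  have hgrid : ∀ k : ℕ, 0 ≤ ψ (k * Δt) := by
    intro k
    induction k with
    | zero => simpa using h0
    | succ k ih =>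
      push_cast
      exact hstep k ih _ ⟨by nlinarith, le_rfl⟩
  intro t ht
  refine hstep ⌊t / Δt⌋₊ (hgrid _) t ⟨?_, ?_⟩
  · exact (le_div_iff₀ hΔ).mp (Nat.floor_le (by positivity))
  · exact ((div_lt_iff₀ hΔ).mp (Nat.lt_floor_add_one _)).le
end

section
/- Let Δt > 0, λ > 0, and let ψ : ℝ → ℝ be twice differentiable on [0, ∞) with ψ(0) ≥ 0. Suppose that for every k ∈ ℕ there exists M_k ≥ 0 such that ψ''(t) ≥ -M_k for all t ∈ [k·Δt, (k+1)·Δt] and ψ'(k·Δt) ≥ ψ(k·Δt)·(exp(-λ·Δt) - 1)/Δt + M_k·Δt/2. Then ψ(t) ≥ 0 for all t ≥ 0, and moreover ψ(k·Δt) ≥ ψ(0)·exp(-λ·k·Δt) for every k ∈ ℕ. -/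
/-- Second-order Taylor lower bound from a lower bound on the second derivative. -/
theorem taylor_lower_bound_of_second_deriv_ge {f f' f'' : ℝ → ℝ} {a b M : ℝ}
    (hf : ∀ t ∈ Set.Icc a b, HasDerivWithinAt f (f' t) (Set.Icc a b) t)
    (hf' : ∀ t ∈ Set.Icc a b, HasDerivWithinAt f' (f'' t) (Set.Icc a b) t)
    (hM : ∀ t ∈ Set.Icc a b, -M ≤ f'' t) {t : ℝ} (ht : t ∈ Set.Icc a b) :
    f a + f' a * (t - a) - M * (t - a) ^ 2 / 2 ≤ f t := by
  have ha : a ∈ Set.Icc a b := ⟨le_rfl, ht.1.trans ht.2⟩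
  have hderiv : ∀ s ∈ Set.Icc a b,
      HasDerivWithinAt (fun x => f' x + M * x) (f'' s + M) (Set.Icc a b) s := fun s hs => 
    ((hf' s hs).add ((hasDerivWithinAt_id s _).const_mul M)).congr_deriv (by ring)
  have hmono : MonotoneOn (fun x => f' x + M * x) (Set.Icc a b) :=
    monotoneOn_of_hasDerivWithinAt_nonneg (convex_Icc a b)
      (fun s hs => (hderiv s hs).continuousWithinAt)
      (fun s hs => (hderiv s (interior_subset hs)).mono interior_subset)
      (fun s hs => by linarith [hM s (interior_subset hs)])
  have hderiv₂ : ∀ s ∈ Set.Icc a b,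
      HasDerivWithinAt (fun x => f x - f' a * (x - a) + M * (x - a) ^ 2 / 2)
        (f' s - f' a + M * (s - a)) (Set.Icc a b) s := fun s hs => by
    have hsub : HasDerivWithinAt (fun x : ℝ => x - a) 1 (Set.Icc a b) s :=
      (hasDerivWithinAt_id s _).sub_const a
    refine (((hf s hs).sub (hsub.const_mul (f' a))).add
      (((hsub.pow 2).const_mul M).div_const 2)).congr_deriv ?_
    push_cast
    ring
  have hmono₂ : MonotoneOn (fun x => f x - f' a * (x - a) + M * (x - a) ^ 2 / 2)
      (Set.Icc a b) :=
    monotoneOn_of_hasDerivWithinAt_nonneg (convex_Icc a b)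
      (fun s hs => (hderiv₂ s hs).continuousWithinAt)
      (fun s hs => (hderiv₂ s (interior_subset hs)).mono interior_subset)
      (fun s hs => by
        have hs' := interior_subset hs
        have := hmono ha hs' hs'.1
        simp only at this
        linarith)
  have := hmono₂ ha ht ht.1
  simp only [sub_self] at this
  linarith


/-- SACBF safety guarantee (Theorem 2) specialized to the exponential lower envelope
L(t_k, Δt) = ψ(t_k)·exp(-λ·Δt): continuous-time nonnegativity of the barrier and an
exponential-decay lower bound at the sampling instants. -/
theorem stmt_9 (Δt lam : ℝ) (hΔ : 0 < Δt) (hlam : 0 < lam)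
    (ψ ψ' ψ'' : ℝ → ℝ)
    (hd1 : ∀ t ∈ Set.Ici (0:ℝ), HasDerivWithinAt ψ (ψ' t) (Set.Ici 0) t)
    (hd2 : ∀ t ∈ Set.Ici (0:ℝ), HasDerivWithinAt ψ' (ψ'' t) (Set.Ici 0) t)
    (h0 : 0 ≤ ψ 0)
    (hk : ∀ k : ℕ, ∃ M : ℝ, 0 ≤ M ∧
      (∀ t ∈ Set.Icc ((k : ℝ) * Δt) (((k : ℝ) + 1) * Δt), ψ'' t ≥ -M) ∧
      ψ' ((k : ℝ) * Δt) ≥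
        ψ ((k : ℝ) * Δt) * (Real.exp (-lam * Δt) - 1) / Δt + M * Δt / 2) :
    (∀ t ≥ (0:ℝ), 0 ≤ ψ t) ∧
      ∀ k : ℕ, ψ ((k : ℝ) * Δt) ≥ ψ 0 * Real.exp (-lam * ((k : ℝ) * Δt)) := by
  have hchord : ∀ k : ℕ, ∀ s ∈ Set.Icc (0 : ℝ) 1,
      ψ (k * Δt) * (1 - s * (1 - Real.exp (-lam * Δt))) ≤ ψ (k * Δt + s * Δt) := by
    intro k s hs
    obtain ⟨M, hM0, hM, hdk⟩ := hk k
    have hsub : Set.Icc ((k : ℝ) * Δt) (((k : ℝ) + 1) * Δt) ⊆ Set.Ici 0 := fun t ht =>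
      (mul_nonneg k.cast_nonneg hΔ.le).trans ht.1
    have hmem : (k : ℝ) * Δt + s * Δt ∈ Set.Icc ((k : ℝ) * Δt) (((k : ℝ) + 1) * Δt) :=
      ⟨by nlinarith [hs.1], by nlinarith [hs.2]⟩
    have htaylor := taylor_lower_bound_of_second_deriv_ge
      (fun t ht => (hd1 t (hsub ht)).mono hsub) (fun t ht => (hd2 t (hsub ht)).mono hsub)
      hM hmem
    rw [add_sub_cancel_left] at htaylor
    have hslope := mul_le_mul_of_nonneg_right hdk (mul_nonneg hs.1 hΔ.le)
    have hexpand : (ψ (k * Δt) * (Real.exp (-lam * Δt) - 1) / Δt + M * Δt / 2) * (s * Δt) =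
        ψ (k * Δt) * (Real.exp (-lam * Δt) - 1) * s + M * Δt ^ 2 * s / 2 := by
      field_simp
    have hrem : 0 ≤ M * Δt ^ 2 * (s * (1 - s)) :=
      mul_nonneg (by positivity) (mul_nonneg hs.1 (sub_nonneg.2 hs.2))
    nlinarith
  have hdecay : ∀ k : ℕ, ψ 0 * Real.exp (-lam * (k * Δt)) ≤ ψ (k * Δt) := by
    intro k
    induction k with
    | zero => simp
    | succ k ih =>
      have hstep := hchord k 1 ⟨zero_le_one, le_rfl⟩
      have hexp : Real.exp (-lam * (((k + 1 : ℕ) : ℝ) * Δt)) =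
          Real.exp (-lam * (k * Δt)) * Real.exp (-lam * Δt) := by
        rw [← Real.exp_add]
        push_cast
        ring_nf
      have hnode : ((k + 1 : ℕ) : ℝ) * Δt = k * Δt + 1 * Δt := by
        push_cast
        ring
      rw [hexp, hnode]
      nlinarith [mul_le_mul_of_nonneg_right ih (Real.exp_pos (-lam * Δt)).le]
  refine ⟨fun t ht => ?_, hdecay⟩
  set k := ⌊t / Δt⌋₊
  have hlo : (k : ℝ) ≤ t / Δt := Nat.floor_le (by positivity)
  have hhi : t / Δt < k + 1 := Nat.lt_floor_add_one _
  have hs : t / Δt - k ∈ Set.Icc (0 : ℝ) 1 := ⟨by linarith, by linarith⟩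
  have ht' : k * Δt + (t / Δt - k) * Δt = t := by
    field_simp
    ring
  have hbound := hchord k _ hs
  rw [ht'] at hbound
  refine le_trans (mul_nonneg ?_ ?_) hbound
  · exact (mul_nonneg h0 (Real.exp_pos _).le).trans (hdecay k)
  · nlinarith [hs.1, hs.2, Real.exp_pos (-lam * Δt)]
end

section
/- Let m ≥ 2, let λ₁, …, λ_m > 0, and let Δt > 0. Let ψ₀, …, ψ_{m-1} : [0, ∞) → ℝ be such that ψ₀, …, ψ_{m-2} are differentiable, ψ_{m-1} is twice differentiable, and ψ_i(t) = ψ_{i-1}'(t) + λ_i·ψ_{i-1}(t) for all t ≥ 0 and i ∈ {1, …, m-1}. Suppose ψ_i(0) ≥ 0 for every i ∈ {0, …, m-1}, and that for every k ∈ ℕ there exists M_k ≥ 0 such that ψ_{m-1}''(t) ≥ -M_k for all t ∈ [k·Δt, (k+1)·Δt] and ψ_{m-1}'(k·Δt) ≥ ψ_{m-1}(k·Δt)·(exp(-λ_m·Δt) - 1)/Δt + M_k·Δt/2. Then ψ_i(t) ≥ 0 for every i ∈ {0, …, m-1} and all t ≥ 0; in particular the safety function ψ₀(t) ≥ 0 for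 all t ≥ 0. -/
/-- Second-order Taylor lower bound from a lower bound on the second derivative. -/
lemma taylor_two_le_of_neg_le_second_deriv {f f' f'' : ℝ → ℝ} {a b M : ℝ}
    (hf : ∀ x ∈ Set.Icc a b, HasDerivWithinAt f (f' x) (Set.Icc a b) x)
    (hf' : ∀ x ∈ Set.Icc a b, HasDerivWithinAt f' (f'' x) (Set.Icc a b) x)
    (hM : ∀ x ∈ Set.Icc a b, -M ≤ f'' x) {x : ℝ} (hx : x ∈ Set.Icc a b) :
    f a + f' a * (x - a) - M * (x - a) ^ 2 / 2 ≤ f x := by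
  have ha : a ∈ Set.Icc a b := ⟨le_rfl, hx.1.trans hx.2⟩
  have hslope : MonotoneOn (fun y => f' y + M * (y - a)) (Set.Icc a b) := by
    have hd : ∀ y ∈ Set.Icc a b,
        HasDerivWithinAt (fun y => f' y + M * (y - a)) (f'' y + M * 1) (Set.Icc a b) y :=
      fun y hy => (hf' y hy).add (((hasDerivWithinAt_id y _).sub_const a).const_mul M)
    refine monotoneOn_of_hasDerivWithinAt_nonneg (convex_Icc a b)
      (fun y hy => (hd y hy).continuousWithinAt)
      (fun y hy => (hd y (interior_subset hy)).mono interior_subset) fun y hy => ?_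
    linarith [hM y (interior_subset hy)]
  have hrem : MonotoneOn (fun y => f y - f' a * (y - a) + M / 2 * (y - a) ^ 2)
      (Set.Icc a b) := by
    have hd : ∀ y ∈ Set.Icc a b,
        HasDerivWithinAt (fun y => f y - f' a * (y - a) + M / 2 * (y - a) ^ 2)
          (f' y - f' a * 1 + M / 2 * ((2 : ℕ) * (y - a) ^ (2 - 1) * 1)) (Set.Icc a b) y :=
      fun y hy => ((hf y hy).sub (((hasDerivWithinAt_id y _).sub_const a).const_mul (f' a))).add
        ((((hasDerivWithinAt_id y _).sub_const a).pow 2).const_mul (M / 2))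
    refine monotoneOn_of_hasDerivWithinAt_nonneg (convex_Icc a b)
      (fun y hy => (hd y hy).continuousWithinAt)
      (fun y hy => (hd y (interior_subset hy)).mono interior_subset) fun y hy => ?_
    have hy' := interior_subset hy
    have := hslope ha hy' hy'.1
    norm_num at this ⊢
    linarith
  have := hrem ha hx hx.1
  norm_num at this
  linarith

/-- If `f' + c * f ≥ 0` on `[0, ∞)` and `f 0 ≥ 0`, then `f ≥ 0` on `[0, ∞)`. -/
lemma nonneg_of_deriv_add_mul_nonneg {f f' : ℝ → ℝ} {c : ℝ}
    (hf : ∀ t ∈ Set.Ici (0 : ℝ), HasDerivWithinAt f (f' t) (Set.Ici 0) t)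
    (h : ∀ t ≥ (0 : ℝ), 0 ≤ f' t + c * f t) (h0 : 0 ≤ f 0) {t : ℝ} (ht : 0 ≤ t) :
    0 ≤ f t := by
  have hd : ∀ y ∈ Set.Ici (0 : ℝ), HasDerivWithinAt (fun y => Real.exp (c * y) * f y)
      (Real.exp (c * y) * (c * 1) * f y + Real.exp (c * y) * f' y) (Set.Ici 0) y :=
    fun y hy => (((hasDerivWithinAt_id y _).const_mul c).exp).mul (hf y hy)
  have hmono : MonotoneOn (fun y => Real.exp (c * y) * f y) (Set.Ici 0) := by
    refine monotoneOn_of_hasDerivWithinAt_nonneg (convex_Ici 0)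
      (fun y hy => (hd y hy).continuousWithinAt)
      (fun y hy => (hd y (interior_subset hy)).mono interior_subset) fun y hy => ?_
    have := mul_nonneg (Real.exp_pos (c * y)).le (h y (interior_subset hy))
    linarith
  have := hmono Set.self_mem_Ici ht ht
  simp only [mul_zero, Real.exp_zero, one_mul] at this
  exact nonneg_of_mul_nonneg_right (h0.trans this) (Real.exp_pos _)

/-- One sampling period: the sampled inequality keeps `f` nonnegative on `[a, a + T]`. -/
lemma nonneg_on_sampling_interval {f f' f'' : ℝ → ℝ} {a T M q : ℝ} (hT : 0 < T) (hM : 0 ≤ M)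
    (hq : 0 ≤ q)
    (hf : ∀ x ∈ Set.Icc a (a + T), HasDerivWithinAt f (f' x) (Set.Icc a (a + T)) x)
    (hf' : ∀ x ∈ Set.Icc a (a + T), HasDerivWithinAt f' (f'' x) (Set.Icc a (a + T)) x)
    (hf'' : ∀ x ∈ Set.Icc a (a + T), -M ≤ f'' x) (ha : 0 ≤ f a)
    (hs : f a * (q - 1) / T + M * T / 2 ≤ f' a) {x : ℝ} (hx : x ∈ Set.Icc a (a + T)) :
    0 ≤ f x := by
  refine le_trans ?_ (taylor_two_le_of_neg_le_second_deriv hf hf' hf'' hx)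
  have hs0 : 0 ≤ x - a := sub_nonneg.2 hx.1
  have hsT : 0 ≤ T - (x - a) := by linarith [hx.2]
  have hslope := mul_le_mul_of_nonneg_right hs hs0
  have hsplit : f a + (f a * (q - 1) / T + M * T / 2) * (x - a) - M * (x - a) ^ 2 / 2
      = f a * ((T - (x - a)) + q * (x - a)) / T + M * ((x - a) * (T - (x - a))) / 2 := by
    field_simp
    ring
  have : 0 ≤ f a * ((T - (x - a)) + q * (x - a)) / T + M * ((x - a) * (T - (x - a))) / 2 := by
    positivity
  linarith


/-- Full SACBF safety guarantee (Theorem 2) in trajectory form for the linear class-κ HOCBF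
cascade ψ_i = ψ_{i-1}' + λ_i·ψ_{i-1}: enforcing the SACBF inequality on ψ_{m-1} only at the
sampling instants renders C₀ ∩ … ∩ C_{m-1} forward invariant in continuous time. -/
theorem stmt_10 (m : ℕ) (hm : 2 ≤ m) (lam : ℕ → ℝ)
    (hlam : ∀ i, 1 ≤ i → i ≤ m → 0 < lam i)
    (Δt : ℝ) (hΔ : 0 < Δt)
    (ψ ψ' : ℕ → ℝ → ℝ) (ψ₂ : ℝ → ℝ)
    (hd1 : ∀ i < m, ∀ t ∈ Set.Ici (0:ℝ), HasDerivWithinAt (ψ i) (ψ' i t) (Set.Ici 0) t)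
    (hd2 : ∀ t ∈ Set.Ici (0:ℝ), HasDerivWithinAt (ψ' (m - 1)) (ψ₂ t) (Set.Ici 0) t)
    (hcascade : ∀ i, 1 ≤ i → i ≤ m - 1 → ∀ t ≥ (0:ℝ),
      ψ i t = ψ' (i - 1) t + lam i * ψ (i - 1) t)
    (hinit : ∀ i < m, 0 ≤ ψ i 0)
    (hk : ∀ k : ℕ, ∃ M : ℝ, 0 ≤ M ∧
      (∀ t ∈ Set.Icc ((k : ℝ) * Δt) (((k : ℝ) + 1) * Δt), ψ₂ t ≥ -M) ∧
      ψ' (m - 1) ((k : ℝ) * Δt) ≥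
        ψ (m - 1) ((k : ℝ) * Δt) * (Real.exp (-lam m * Δt) - 1) / Δt + M * Δt / 2) :
    ∀ i < m, ∀ t ≥ (0:ℝ), 0 ≤ ψ i t := by
  have hIcc : ∀ k : ℕ, Set.Icc ((k : ℝ) * Δt) ((k : ℝ) * Δt + Δt) ⊆ Set.Ici 0 :=
    fun k t ht => (by positivity : (0 : ℝ) ≤ (k : ℝ) * Δt).trans ht.1
  have hstep : ∀ k : ℕ, 0 ≤ ψ (m - 1) (k * Δt) →
      ∀ t ∈ Set.Icc ((k : ℝ) * Δt) ((k : ℝ) * Δt + Δt), 0 ≤ ψ (m - 1) t := by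
    intro k h0 t ht
    obtain ⟨M, hM, hbound, hsample⟩ := hk k
    rw [add_one_mul] at hbound
    exact nonneg_on_sampling_interval hΔ hM (Real.exp_pos _).le
      (fun x hx => (hd1 (m - 1) (by omega) x (hIcc k hx)).mono (hIcc k))
      (fun x hx => (hd2 x (hIcc k hx)).mono (hIcc k)) hbound h0 hsample ht
  have hsampled : ∀ k : ℕ, 0 ≤ ψ (m - 1) (k * Δt) := by
    intro k
    induction k with
    | zero => simpa using hinit (m - 1) (by omega)
    | succ k ih =>
      rw [Nat.cast_succ, add_one_mul]
      exact hstep k ih _ ⟨by linarith, le_rfl⟩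
  have htop : ∀ t ≥ (0 : ℝ), 0 ≤ ψ (m - 1) t := by
    intro t ht
    refine hstep ⌊t / Δt⌋₊ (hsampled _) t ⟨?_, ?_⟩
    · exact (le_div_iff₀ hΔ).1 (Nat.floor_le (by positivity))
    · rw [← add_one_mul]
      exact ((div_lt_iff₀ hΔ).1 (Nat.lt_floor_add_one _)).le
  intro i hi
  induction Nat.le_sub_one_of_lt hi using Nat.decreasingInduction with
  | self => exact htop
  | of_succ j hj ih =>
    intro t ht
    refine nonneg_of_deriv_add_mul_nonneg (c := lam (j + 1)) (hd1 j (by omega))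
      (fun s hs => ?_) (hinit j (by omega)) ht
    have := hcascade (j + 1) (by omega) (by omega) s hs
    rw [Nat.add_sub_cancel] at this
    exact this ▸ ih (by omega) s hs
end
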